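/- For every n ≥ 1, C_{{0,1}^ℕ,#=n+1} ≤_W (C_{{0,1}^ℕ,#=2})^n and C_{{0,1}^ℕ,#≤n+1} ≤_W (C_{{0,1}^ℕ,#≤2})^n: choice for an (n+1)-point closed subset of Cantor space is topologically Weihrauch reducible to the n-fold parallel product of choice for 2-point closed subsets, and likewise for the at-most versions. -/

import Mathlib

/-! Framework: represented spaces, realizers, (strong) topological Weihrauch reducibility. -/

/-- Baire space ℕ^ℕ (with the product topology). -/
abbrev Baire : Type := ℕ → ℕ

/-- A standard pairing ⟨p, q⟩ on Baire space (interleaving). -/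
def pairB (p q : Baire) : Baire := fun n => if n % 2 = 0 then p (n / 2) else q (n / 2)

/-- A representation of `X`: the name relation of a partial map from Baire space to `X`
(`R p x` means that `p` is a name of `x`). -/
structure RepSp (X : Type*) where
  R : Baire → X → Prop

/-- Restriction of a representation to names in `A` (used for restrictions `f_A`). -/
def RepSp.restrict {X : Type*} (δ : RepSp X) (A : Set Baire) : RepSp X :=
  ⟨fun p x => δ.R p x ∧ p ∈ A⟩

/-- `F` is a realizer of the multivalued function `f` (whose domain is
`{x | (f x).Nonempty}`) with respect to the given representations. -/
def Realizes {X Y : Type*} (δX : RepSp X) (δY : RepSp Y) (f : X → Set Y)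
    (F : Baire → Baire) : Prop :=
  ∀ p x, δX.R p x → (f x).Nonempty → ∃ y ∈ f x, δY.R (F p) y

/-- Topological Weihrauch reducibility `f ≤_W g`: there are continuous partial functions
`H` (pre-processor) and `K` (post-processor) on Baire space such that
`p ↦ K⟨p, G (H p)⟩` realizes `f` for every realizer `G` of `g`. -/
def WRed {X Y U V : Type*} (δX : RepSp X) (δY : RepSp Y) (δU : RepSp U) (δV : RepSp V)
    (f : X → Set Y) (g : U → Set V) : Prop :=
  ∃ (H K : Baire → Baire) (dH dK : Set Baire), ContinuousOn H dH ∧ ContinuousOn K dK ∧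
    ∀ G : Baire → Baire, Realizes δU δV g G →
      ∀ p x, δX.R p x → (f x).Nonempty →
        p ∈ dH ∧ pairB p (G (H p)) ∈ dK ∧
          ∃ y ∈ f x, δY.R (K (pairB p (G (H p)))) y

/-- Strong topological Weihrauch reducibility `f ≤_sW g`:
`K ∘ G ∘ H` realizes `f` for every realizer `G` of `g`. -/
def SWRed {X Y U V : Type*} (δX : RepSp X) (δY : RepSp Y) (δU : RepSp U) (δV : RepSp V)
    (f : X → Set Y) (g : U → Set V) : Prop :=
  ∃ (H K : Baire → Baire) (dH dK : Set Baire), ContinuousOn H dH ∧ ContinuousOn K dK ∧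
    ∀ G : Baire → Baire, Realizes δU δV g G →
      ∀ p x, δX.R p x → (f x).Nonempty →
        p ∈ dH ∧ G (H p) ∈ dK ∧ ∃ y ∈ f x, δY.R (K (G (H p))) y

/-! Negative representation of closed subsets of a separable metric space with a
fixed dense sequence, Cauchy representation of points, and choice principles. -/

/-- An enumeration of the nonnegative rationals (as reals): `n ↦ a/(b+1)` with `(a,b)` = unpair. -/
noncomputable def ratCode (n : ℕ) : ℝ := (n.unpair.1 : ℝ) / ((n.unpair.2 : ℝ) + 1)

/-- The rational open ball of `X` coded by `n` (center from the dense sequence `α`,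
rational radius; radius `0` yields the empty ball, allowing padding). -/
noncomputable def ballCode {X : Type*} [MetricSpace X] (α : ℕ → X) (n : ℕ) : Set X :=
  Metric.ball (α n.unpair.1) (ratCode n.unpair.2)

/-- The negative representation `ψ₋` of closed sets: a name `p` enumerates rational open
balls and denotes `X` minus their union. -/
noncomputable def psiMinus {X : Type*} [MetricSpace X] (α : ℕ → X) (p : Baire) : Set X :=
  {x | ∀ i, x ∉ ballCode α (p i)}

/-- The represented space `A(X)` of closed subsets of `X` (negative information). -/
noncomputable def closedRep {X : Type*} [MetricSpace X] (α : ℕ → X) : RepSp (Set X) :=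
  ⟨fun p A => A = psiMinus α p⟩

/-- The Cauchy representation of points of `X` (w.r.t. the dense sequence `α`). -/
noncomputable def pointRep {X : Type*} [MetricSpace X] (α : ℕ → X) : RepSp X :=
  ⟨fun p x => ∀ i, dist x (α (p i)) < (2:ℝ)⁻¹ ^ i⟩

/-- Closed choice restricted to a class `𝔄` of sets: the multivalued map `A ↦ A` with
domain the nonempty members of `𝔄`. -/
def choiceFn {X : Type*} (𝔄 : Set (Set X)) : Set X → Set X :=
  fun A => {x | A ∈ 𝔄 ∧ x ∈ A}

/-- The class of (finite) sets of cardinality exactly `n`. -/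
def cardEqClass (X : Type*) (n : ℕ) : Set (Set X) := {A | A.Finite ∧ A.ncard = n}

/-- The class of nonempty (finite) sets of cardinality at most `n`. -/
def cardLeClass (X : Type*) (n : ℕ) : Set (Set X) :=
  {A | A.Finite ∧ A.Nonempty ∧ A.ncard ≤ n}

/-- The unit cube `[0,1]^n` inside `ℝ^n`. -/
def unitCube (n : ℕ) : Set (Fin n → ℝ) := Set.univ.pi fun _ => Set.Icc (0:ℝ) 1

/-- The class of nonempty closed convex subsets of the unit cube `[0,1]^n`. -/
def convexClass (n : ℕ) : Set (Set (Fin n → ℝ)) :=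
  {A | A.Nonempty ∧ IsClosed A ∧ Convex ℝ A ∧ A ⊆ unitCube n}

/-! Discrete spaces, Cantor space, products, composition, fractals. -/

/-- Cantor space `{0,1}^ℕ`, with the standard (first-difference) metric, whose topology
is the product topology. -/
noncomputable instance : MetricSpace (ℕ → Bool) := PiNat.metricSpace

/-- Representation of closed subsets of the discrete space `Fin k`:
a name enumerates the complement (`0` codes "nothing", `m+1` codes `m`). -/
def finSetRep (k : ℕ) : RepSp (Set (Fin k)) :=
  ⟨fun p A => A = {m : Fin k | ∀ i, p i ≠ (m : ℕ) + 1}⟩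

/-- Representation of points of the discrete space `Fin k`: `p` names `m` iff `p 0 = m`. -/
def finPointRep (k : ℕ) : RepSp (Fin k) := ⟨fun p m => p 0 = (m : ℕ)⟩

/-- Representation of closed subsets of the discrete space `ℕ`:
a name enumerates the complement (`0` codes "nothing", `m+1` codes `m`). -/
def natSetRep : RepSp (Set ℕ) := ⟨fun p A => A = {m : ℕ | ∀ i, p i ≠ m + 1}⟩

/-- Representation of points of the discrete space `ℕ`: `p` names `m` iff `p 0 = m`. -/
def natPointRep : RepSp ℕ := ⟨fun p m => p 0 = m⟩

/-- The `i`-th component of a name of an `n`-tuple (interleaving `n` streams). -/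
def projB (n : ℕ) (i : Fin n) (p : Baire) : Baire := fun k => p (k * n + i)

/-- Representation of `n`-tuples: a name codes `n` names, interleaved. -/
def piRep {X : Type*} (n : ℕ) (δ : RepSp X) : RepSp (Fin n → X) :=
  ⟨fun p x => ∀ i, δ.R (projB n i p) (x i)⟩

/-- The `n`-fold parallel product `f^n` of a multivalued function. -/
def piFn {X Y : Type*} (n : ℕ) (f : X → Set Y) : (Fin n → X) → Set (Fin n → Y) :=
  fun x => {y | ∀ i, y i ∈ f (x i)}

/-- Composition `g ∘ h` of multivalued functions: defined on those `t ∈ dom h` with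
`h t ⊆ dom g`, mapping `t` to `⋃ {g u | u ∈ h t}`. -/
def mcomp {T U V : Type*} (g : U → Set V) (h : T → Set U) : T → Set V :=
  fun t => {v | (h t).Nonempty ∧ (∀ u ∈ h t, (g u).Nonempty) ∧ ∃ u ∈ h t, v ∈ g u}

/-- `f` is a fractal: there is a multivalued `g` on a represented space with nonempty
carrier such that for every clopen `A` of Baire space the restriction `g_A` of `g` to
inputs with names in `A` is Weihrauch equivalent to `f`, or to the nowhere defined
function `0` (i.e. `g_A` has empty domain). -/
def Fractal {X Y : Type*} (δX : RepSp X) (δY : RepSp Y) (f : X → Set Y) : Prop :=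
  ∃ (Z W : Type) (δZ : RepSp Z) (δW : RepSp W) (g : Z → Set W), Nonempty Z ∧
    ∀ A : Set Baire, IsClopen A →
      (WRed (δZ.restrict A) δW δX δY g f ∧ WRed δX δY (δZ.restrict A) δW f g)
      ∨ ¬ ∃ p z, δZ.R p z ∧ p ∈ A ∧ (g z).Nonempty

/-- `f` is a closed fractal: as `Fractal`, with the witnessing representation total. -/
def ClosedFractal {X Y : Type*} (δX : RepSp X) (δY : RepSp Y) (f : X → Set Y) : Prop :=
  ∃ (Z W : Type) (δZ : RepSp Z) (δW : RepSp W) (g : Z → Set W), Nonempty Z ∧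
    (∀ p : Baire, ∃ z, δZ.R p z) ∧
    ∀ A : Set Baire, IsClopen A →
      (WRed (δZ.restrict A) δW δX δY g f ∧ WRed δX δY (δZ.restrict A) δW f g)
      ∨ ¬ ∃ p z, δZ.R p z ∧ p ∈ A ∧ (g z).Nonempty

/-- `X_ε(𝔄)`: the closure (in Baire space) of the set of `ψ₋`-names of sets `A ∈ 𝔄` such
that for every `x ∈ X` some `B ∈ 𝔄` satisfies `B ⊆ A \ B(x, ε)`. -/
noncomputable def Xeps {X : Type*} [MetricSpace X] (α : ℕ → X) (𝔄 : Set (Set X))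
    (ε : ℝ) : Set Baire :=
  closure {p | psiMinus α p ∈ 𝔄 ∧
    ∀ x : X, ∃ B ∈ 𝔄, B ⊆ psiMinus α p \ Metric.ball x ε}

/-- The represented space `ℝ_>`: a name is a nonincreasing sequence of rationals
converging to `x` (approximation from above). -/
noncomputable def gtRep : RepSp ℝ :=
  ⟨fun p x => (∀ i, ((Denumerable.ofNat ℚ (p (i+1)) : ℚ) : ℝ) ≤ ((Denumerable.ofNat ℚ (p i) : ℚ) : ℝ)) ∧
    Filter.Tendsto (fun i => ((Denumerable.ofNat ℚ (p i) : ℚ) : ℝ)) Filter.atTop (nhds x)⟩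

/-! ### Branching words of finite sets of words -/

/-- The words at which the tree of prefixes of words in `T` branches. -/
def branching (T : Set (List Bool)) : Set (List Bool) :=
  {w | ∀ b, ∃ v ∈ T, w ++ [b] <+: v}

theorem branching_insert_subset (T : Set (List Bool)) (v : List Bool) :
    branching T ⊆ branching (insert v T) := fun _ hw b =>
  let ⟨u, hu, h⟩ := hw b
  ⟨u, Set.mem_insert_of_mem _ hu, h⟩

theorem eq_of_append_singleton_prefix {w v : List Bool} {b c : Bool}
    (hb : w ++ [b] <+: v) (hc : w ++ [c] <+: v) : b = c := by
  have := List.prefix_of_prefix_length_le hb hc (by simp)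
  simpa [List.prefix_append_right_inj] using this

theorem append_singleton_prefix_of_length_lt {w u v : List Bool} {b : Bool}
    (hw : w ++ [b] <+: v) (hu : u <+: v) (h : w.length < u.length) : w ++ [b] <+: u :=
  List.prefix_of_prefix_length_le hw hu (by simpa using h)

/-- Adding one word creates at most one new branching word. -/
theorem subsingleton_branching_insert_diff (T : Set (List Bool)) (v : List Bool) :
    (branching (insert v T) \ branching T).Subsingleton := by
  have key : ∀ w ∈ branching (insert v T) \ branching T,
      ∃ b, w ++ [b] <+: v ∧ ∀ u ∈ T, ¬ w ++ [b] <+: u := by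
    rintro w ⟨hw, hw'⟩
    simp only [branching, Set.mem_ofPred_eq, not_forall, not_exists, not_and] at hw'
    obtain ⟨b, hb⟩ := hw'
    obtain ⟨u, hu, h⟩ := hw b
    rcases hu with rfl | hu
    · exact ⟨b, h, hb⟩
    · exact absurd h (hb u hu)
  have hnlt : ∀ w ∈ branching (insert v T) \ branching T,
      ∀ w' ∈ branching (insert v T) \ branching T, ¬ w.length < w'.length := by
    intro w hw w' hw' hlt
    obtain ⟨b, hb, hbT⟩ := key w hw
    obtain ⟨c, hc, -⟩ := key w' hw'
    have h1 : w ++ [b] <+: w' :=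
      append_singleton_prefix_of_length_lt hb ((List.prefix_append _ _).trans hc) hlt
    obtain ⟨u, hu, h⟩ := hw'.1 (!c)
    rcases hu with rfl | hu
    · simpa using eq_of_append_singleton_prefix hc h
    · exact hbT u hu (h1.trans ((List.prefix_append _ _).trans h))
  intro w hw w' hw'
  obtain ⟨b, hb, -⟩ := key w hw
  obtain ⟨c, hc, -⟩ := key w' hw'
  have hlen : w.length = w'.length :=
    le_antisymm (not_lt.1 (hnlt w' hw' w hw)) (not_lt.1 (hnlt w hw w' hw'))
  exact (List.prefix_of_prefix_length_le ((List.prefix_append _ _).trans hb)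
    ((List.prefix_append _ _).trans hc) hlen.le).eq_of_length hlen

theorem branching_singleton (v : List Bool) : branching {v} = ∅ := by
  ext w
  simp only [branching, Set.mem_singleton_iff, exists_eq_left, Set.mem_ofPred_eq,
    Set.mem_empty_iff_false, iff_false]
  intro h
  simpa using eq_of_append_singleton_prefix (h true) (h false)

/-- A tree with finitely many leaves has fewer branching nodes than leaves. -/
theorem finite_branching_and_ncard {T : Set (List Bool)} (hT : T.Finite) (hne : T.Nonempty) :
    (branching T).Finite ∧ (branching T).ncard + 1 ≤ T.ncard := by
  induction T, hT using Set.Finite.induction_on with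
  | empty => simp at hne
  | @insert v T hv hT ih =>
    rcases T.eq_empty_or_nonempty with rfl | hT'
    · simp [branching_singleton]
    · obtain ⟨hfin, hcard⟩ := ih hT'
      have hss := subsingleton_branching_insert_diff T v
      have hdiff := hss.finite
      have hun : branching (insert v T) =
          branching T ∪ (branching (insert v T) \ branching T) := by
        rw [Set.union_sdiff_cancel (branching_insert_subset T v)]
      have h1 : (branching (insert v T) \ branching T).ncard ≤ 1 :=
        (Set.ncard_le_one hdiff).2 fun a ha b hb => hss ha hb
      refine ⟨hun ▸ hfin.union hdiff, ?_⟩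
      rw [Set.ncard_insert_of_notMem hv hT, hun]
      have := Set.ncard_union_le (branching T) (branching (insert v T) \ branching T)
      omega

/-! ### Assigning indices to branching words -/

/-- An injection on part of a set of size at most `n` into `{0, …, n - 1}` extends to
the whole set. -/
theorem exists_injOn_extension {α : Type*} {n : ℕ} {C B : Set α} (hCB : C ⊆ B) (hB : B.Finite)
    (hn : B.ncard ≤ n) {f : α → ℕ} (hf : Set.InjOn f C) (hfn : Set.MapsTo f C (Set.Iio n)) :
    ∃ g : α → ℕ, Set.EqOn g f C ∧ Set.InjOn g B ∧ Set.MapsTo g B (Set.Iio n) := by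
  classical
  suffices H : ∀ D : Set α, D.Finite → C ∪ D ⊆ B →
      ∃ g : α → ℕ, Set.EqOn g f C ∧ Set.InjOn g (C ∪ D) ∧ Set.MapsTo g (C ∪ D) (Set.Iio n) by
    simpa [Set.union_eq_right.2 hCB] using H B hB (by simp [hCB])
  intro D hD
  induction D, hD using Set.Finite.induction_on with
  | empty => exact fun _ => ⟨f, fun _ _ => rfl, by simpa using hf, by simpa using hfn⟩
  | @insert a D _ _ ih =>
    intro hsub
    rw [Set.union_insert] at hsub ⊢
    obtain ⟨g, hg, hinj, hmaps⟩ := ih ((Set.subset_insert _ _).trans hsub)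
    by_cases ha : a ∈ C ∪ D
    · rw [Set.insert_eq_of_mem ha]
      exact ⟨g, hg, hinj, hmaps⟩
    have hfin : (C ∪ D).Finite := hB.subset ((Set.subset_insert _ _).trans hsub)
    have hlt : (g '' (C ∪ D)).ncard < (Set.Iio n).ncard := by
      have h1 := Set.ncard_le_ncard hsub hB
      rw [Set.ncard_insert_of_notMem ha hfin] at h1
      have h2 := Set.ncard_image_le (f := g) hfin
      have h3 : (Set.Iio n).ncard = n := by simp [Set.ncard_eq_toFinset_card']
      omega
    obtain ⟨m, hm, hm'⟩ := Set.exists_mem_notMem_of_ncard_lt_ncard hlt (hfin.image g)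
    have hupd : Set.EqOn (Function.update g a m) g (C ∪ D) := fun x hx =>
      Function.update_of_ne (by rintro rfl; exact ha hx) _ _
    refine ⟨Function.update g a m, ?_, ?_, ?_⟩
    · exact (hupd.mono Set.subset_union_left).trans hg
    · rw [Set.injOn_insert ha]
      refine ⟨hinj.congr hupd.symm, ?_⟩
      rw [hupd.image_eq]
      simpa using hm'
    · rintro x (rfl | hx)
      · simpa using hm
      · rw [hupd hx]
        exact hmaps hx

open Classical in
/-- Some extension of the injection `f` on `C` to an injection of `B` into `{0, …, n - 1}`,
if there is one. -/
noncomputable def extendIndex (n : ℕ) (C B : Set (List Bool)) (f : List Bool → ℕ) :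
    List Bool → ℕ :=
  if h : ∃ g : List Bool → ℕ,
      Set.EqOn g f C ∧ Set.InjOn g B ∧ Set.MapsTo g B (Set.Iio n) then h.choose else f

/-- Indices for the branching words of `T k`, such that a word keeps its index as long as it
stays branching. -/
noncomputable def index (n : ℕ) (T : ℕ → Set (List Bool)) : ℕ → List Bool → ℕ
  | 0 => fun _ => 0
  | k + 1 => extendIndex n (branching (T k) ∩ branching (T (k + 1))) (branching (T (k + 1)))
      (index n T k)

open Classical in
/-- `some c` if the index `i` is released between stages `k` and `k + 1` of `T`, where `c` is the
direction to be taken at the word with index `i`, and `none` otherwise. -/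
noncomputable def release (n : ℕ) (T : ℕ → Set (List Bool)) (i k : ℕ) : Option Bool :=
  if ∃ w ∈ branching (T k) \ branching (T (k + 1)), index n T k w = i then
    some (decide (∃ w ∈ branching (T k) \ branching (T (k + 1)), index n T k w = i ∧
      ∃ v ∈ T (k + 1), w ++ [true] <+: v))
  else none

/-- The direction taken by `descend` at `w`, a word of length `k`. -/
noncomputable def direction (n : ℕ) (T : ℕ → Set (List Bool)) (x : ℕ → ℕ → Bool) (k : ℕ)
    (w : List Bool) : Bool :=
  open Classical in
  if w ++ [true] ∈ T (k + 1) ∧ w ++ [false] ∈ T (k + 1) then x (index n T (k + 1) w) (k + 1)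
  else decide (w ++ [true] ∈ T (k + 1))

/-- The path through `T` that follows the answers `x` at branching words. -/
noncomputable def descend (n : ℕ) (T : ℕ → Set (List Bool)) (x : ℕ → ℕ → Bool) :
    ℕ → List Bool
  | 0 => []
  | k + 1 => descend n T x k ++ [direction n T x k (descend n T x k)]

/-- `T k` is a nonempty set of at most `n + 1` words of length `k`, and these form a tree. -/
structure IsNarrowTree (n : ℕ) (T : ℕ → Set (List Bool)) : Prop where
  length_eq : ∀ k, ∀ w ∈ T k, w.length = k
  parent_mem : ∀ k w b, w ++ [b] ∈ T (k + 1) → w ∈ T k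
  nonempty : ∀ k, (T k).Nonempty
  ncard_le : ∀ k, (T k).ncard ≤ n + 1

namespace IsNarrowTree

variable {n : ℕ} {T : ℕ → Set (List Bool)}

theorem finite (h : IsNarrowTree n T) (k : ℕ) : (T k).Finite :=
  (List.finite_length_eq Bool k).subset (h.length_eq k)

theorem index_spec (h : IsNarrowTree n T) (k : ℕ) :
    Set.InjOn (index n T k) (branching (T k)) ∧
      Set.MapsTo (index n T k) (branching (T k)) (Set.Iio n) ∧
      Set.EqOn (index n T (k + 1)) (index n T k) (branching (T k) ∩ branching (T (k + 1))) := by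
  have step : ∀ k, Set.InjOn (index n T k) (branching (T k)) →
      Set.MapsTo (index n T k) (branching (T k)) (Set.Iio n) →
      Set.EqOn (index n T (k + 1)) (index n T k) (branching (T k) ∩ branching (T (k + 1))) ∧
      Set.InjOn (index n T (k + 1)) (branching (T (k + 1))) ∧
      Set.MapsTo (index n T (k + 1)) (branching (T (k + 1))) (Set.Iio n) := by
    intro k hinj hmaps
    obtain ⟨hfin, hcard⟩ := finite_branching_and_ncard (h.finite (k + 1)) (h.nonempty (k + 1))
    have hex := exists_injOn_extension (n := n) Set.inter_subset_right hfin
      (by have := h.ncard_le (k + 1); omega)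
      (hinj.mono (Set.inter_subset_left (t := branching (T (k + 1)))))
      (hmaps.mono_left Set.inter_subset_left)
    simp only [index, extendIndex, dif_pos hex]
    exact hex.choose_spec
  have base : branching (T 0) = ∅ := by
    refine Set.eq_empty_of_forall_notMem fun w hw => ?_
    obtain ⟨v, hv, hp⟩ := hw true
    have := hp.length_le
    simp [h.length_eq 0 v hv] at this
  have both : Set.InjOn (index n T k) (branching (T k)) ∧
      Set.MapsTo (index n T k) (branching (T k)) (Set.Iio n) := by
    induction k with
    | zero => simp [base, Set.MapsTo]
    | succ k ih => exact (step k ih.1 ih.2).2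
  exact ⟨both.1, both.2, (step k both.1 both.2).1⟩

theorem release_eq_some (h : IsNarrowTree n T) {k : ℕ} {w : List Bool} {b : Bool}
    (hw : w ∈ branching (T k) \ branching (T (k + 1)))
    (hb : ∃ v ∈ T (k + 1), w ++ [b] <+: v) :
    release n T (index n T k w) k = some b := by
  classical
  rw [release, if_pos ⟨w, hw, rfl⟩]
  refine congrArg some ?_
  cases b with
  | true => exact decide_eq_true ⟨w, hw, rfl, hb⟩
  | false =>
    refine decide_eq_false ?_
    rintro ⟨w', hw', hi, hv⟩
    rw [(h.index_spec k).1 hw'.1 hw.1 hi] at hv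
    exact hw.2 (by rintro (_ | _) <;> assumption)

theorem release_eq_none (h : IsNarrowTree n T) {k : ℕ} {w : List Bool}
    (hw : w ∈ branching (T k) ∩ branching (T (k + 1))) :
    release n T (index n T k w) k = none := by
  rw [release, if_neg]
  rintro ⟨w', hw', hi⟩
  rw [(h.index_spec k).1 hw'.1 hw.1 hi] at hw'
  exact hw'.2 hw.2

theorem exists_mem_prefix (h : IsNarrowTree n T) {k : ℕ} {w : List Bool} (hw : w.length ≤ k)
    (hv : ∃ v ∈ T (k + 1), w <+: v) : ∃ v ∈ T k, w <+: v := by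
  obtain ⟨v, hv, hp⟩ := hv
  have hlen := h.length_eq _ v hv
  have hne : v ≠ [] := by rintro rfl; simp at hlen
  rw [← List.dropLast_append_getLast hne] at hv hp
  refine ⟨v.dropLast, h.parent_mem _ _ _ hv, ?_⟩
  exact List.prefix_of_prefix_length_le hp (List.prefix_append _ _) (by simp [hlen, hw])

end IsNarrowTree

/-- The closed condition on answers to a question at time `k`: the answer is kept if
`r = none`; it has to be `c`, and is forgotten afterwards, if `r = some c`. -/
def answerStep (r : Option Bool) (k : ℕ) : Set (ℕ → Bool) :=
  {x | (r = none → x (k + 1) = x k) ∧ ∀ c, r = some c → x k = c}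

/-- The set of sequences of answers compatible with the sequence `r`. -/
def answerSet (r : ℕ → Option Bool) : Set (ℕ → Bool) := {x | ∀ k, x ∈ answerStep (r k) k}

namespace IsNarrowTree

variable {n : ℕ} {T : ℕ → Set (List Bool)}

/-- If a word of `T k` is not a prefix of a word of `T (k + 1)`, then some branching word below
it is no longer branching, and directs away from it. -/
theorem exists_release_of_dead (h : IsNarrowTree n T) {k : ℕ} {v : List Bool} (hv : v ∈ T k)
    (hdead : ∀ b, v ++ [b] ∉ T (k + 1)) :
    ∃ w b, w ∈ branching (T k) ∧ w ++ [b] <+: v ∧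
      release n T (index n T k w) k = some (!b) := by
  classical
  have hlen := h.length_eq k v hv
  let P : ℕ → Prop := fun j => ∃ u ∈ T (k + 1), v.take j <+: u
  have hP0 : P 0 := by
    obtain ⟨u, hu⟩ := h.nonempty (k + 1)
    exact ⟨u, hu, by simp⟩
  have hPk : ¬ P k := by
    rintro ⟨u, hu, hp⟩
    rw [← hlen, List.take_length] at hp
    obtain ⟨t, rfl⟩ := hp
    have := h.length_eq _ _ hu
    obtain ⟨b, rfl⟩ : ∃ b, t = [b] := List.length_eq_one_iff.1 (by simp at this; omega)
    exact hdead b hu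
  obtain ⟨j, hjk, hj, hj'⟩ : ∃ j < k, P j ∧ ¬ P (j + 1) := by
    by_contra! hcon
    have : ∀ j ≤ k, P j := by
      intro j hj
      induction j with
      | zero => exact hP0
      | succ j ih => exact hcon j (by omega) (ih (by omega))
    exact hPk (this k le_rfl)
  have htake : v.take (j + 1) = v.take j ++ [v[j]] := by simp
  have hlenj : (v.take j).length = j := by simp; omega
  obtain ⟨u, hu, t, rfl⟩ := hj
  have hulen := h.length_eq _ _ hu
  obtain ⟨c, t, rfl⟩ : ∃ c t', t = c :: t' := by
    cases t with
    | nil => simp at hulen; omega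
    | cons c t => exact ⟨c, t, rfl⟩
  have hcp : v.take j ++ [c] <+: v.take j ++ c :: t := by
    simp [List.prefix_append_right_inj]
  have hc : c = !v[j] := by
    by_contra hne
    have : c = v[j] := by revert hne; cases c <;> cases v[j] <;> simp
    exact hj' ⟨_, hu, by rw [htake, ← this]; exact hcp⟩
  have hvp : v.take j ++ [v[j]] <+: v := by rw [← htake]; exact List.take_prefix _ _
  have halive : ∃ u ∈ T (k + 1), v.take j ++ [!v[j]] <+: u := ⟨_, hu, hc ▸ hcp⟩
  have hbr : v.take j ∈ branching (T k) := by
    intro b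
    by_cases hb : b = v[j]
    · exact ⟨v, hv, hb ▸ hvp⟩
    · have hb' : b = !v[j] := by revert hb; cases b <;> cases v[j] <;> simp
      exact hb' ▸ h.exists_mem_prefix (by simp; omega) halive
  refine ⟨v.take j, v[j], hbr, hvp, h.release_eq_some ⟨hbr, fun hb => hj' ?_⟩ halive⟩
  obtain ⟨u, hu, hp⟩ := hb v[j]
  exact ⟨u, hu, htake ▸ hp⟩

/-- Following compatible answers never leaves the tree. -/
theorem descend_mem (h : IsNarrowTree n T) {x : ℕ → ℕ → Bool}
    (hx : ∀ i < n, x i ∈ answerSet (release n T i)) (k : ℕ) :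
    descend n T x k ∈ T k ∧ ∀ w ∈ branching (T k), ∀ b,
      w ++ [b] <+: descend n T x k → x (index n T k w) k = b := by
  induction k with
  | zero =>
    constructor
    · obtain ⟨v, hv⟩ := h.nonempty 0
      rwa [List.length_eq_zero_iff.1 (h.length_eq 0 v hv)] at hv
    · intro w _ b hp
      have := hp.length_le
      simp [descend] at this
  | succ k ih =>
    obtain ⟨hmem, hinv⟩ := ih
    set v := descend n T x k with hv
    have hlen := h.length_eq k v hmem
    have hsucc : descend n T x (k + 1) = v ++ [direction n T x k v] := rfl
    have halive : ∃ b, v ++ [b] ∈ T (k + 1) := by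
      by_contra! hdead
      obtain ⟨w, b, hw, hp, hr⟩ := h.exists_release_of_dead hmem hdead
      have h1 := (hx _ ((h.index_spec k).2.1 hw) k).2 _ hr
      rw [hinv w hw b hp] at h1
      simp at h1
    have hmem' : v ++ [direction n T x k v] ∈ T (k + 1) := by
      unfold direction
      split_ifs with hboth
      · cases x (index n T (k + 1) v) (k + 1)
        exacts [hboth.2, hboth.1]
      · by_cases ht : v ++ [true] ∈ T (k + 1)
        · simp [ht]
        · obtain ⟨_ | _, hb⟩ := halive
          · simpa [ht] using hb
          · exact absurd hb ht
    refine ⟨hsucc ▸ hmem', fun w hw b hp => ?_⟩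
    rw [hsucc] at hp
    have hwlen : w.length ≤ k := by
      have := hp.length_le
      simp at this
      omega
    rcases hwlen.lt_or_eq with hlt | heq
    · have hp' : w ++ [b] <+: v :=
        List.prefix_of_prefix_length_le hp (List.prefix_append _ _) (by simp; omega)
      have hwk : w ∈ branching (T k) := fun c =>
        h.exists_mem_prefix (by simp; omega) (hw c)
      rw [(h.index_spec k).2.2 ⟨hwk, hw⟩,
        (hx _ ((h.index_spec k).2.1 hwk) k).1 (h.release_eq_none ⟨hwk, hw⟩)]
      exact hinv w hwk b hp'
    · have hwv : w = v := by
        refine (List.prefix_of_prefix_length_le ((List.prefix_append _ _).trans hp)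
          (List.prefix_append _ _) (by omega)).eq_of_length (by omega)
      have hb : b = direction n T x k v := by
        rw [hwv] at hp
        simpa [List.prefix_append_right_inj] using hp
      have hfull : ∀ c, v ++ [c] ∈ T (k + 1) := by
        intro c
        obtain ⟨u, hu, hpu⟩ := hw c
        rw [hwv] at hpu
        rwa [hpu.eq_of_length (by simp [h.length_eq _ u hu, hlen])]
      rw [hwv, hb, direction, if_pos ⟨hfull true, hfull false⟩]

end IsNarrowTree

/-! ### Sets of compatible answers have one or two elements -/

section AnswerSet

variable {r : ℕ → Option Bool}

/-- The element of `answerSet r` that eventually equals `b` if `r` is eventually `none`. -/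
noncomputable def answerSeq (r : ℕ → Option Bool) (b : Bool) (k : ℕ) : Bool :=
  open Classical in
  if h : ∃ j, k ≤ j ∧ (r j).isSome then (r (Nat.find h)).getD b else b

theorem answerSeq_mem (r : ℕ → Option Bool) (b : Bool) : answerSeq r b ∈ answerSet r := by
  classical
  refine fun k => ⟨fun hk => ?_, fun c hk => ?_⟩
  · have hiff : ∀ j, (k + 1 ≤ j ∧ (r j).isSome) ↔ (k ≤ j ∧ (r j).isSome) := by
      refine fun j => ⟨fun h => ⟨by omega, h.2⟩, fun h => ⟨?_, h.2⟩⟩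
      rcases h.1.eq_or_lt with rfl | hlt
      · simp [hk] at h
      · exact hlt
    simp only [answerSeq, hiff]
  · have h : ∃ j, k ≤ j ∧ (r j).isSome := ⟨k, le_rfl, by simp [hk]⟩
    have hfind : Nat.find h = k := (Nat.find_eq_iff h).2 ⟨⟨le_rfl, by simp [hk]⟩, by omega⟩
    simp only [answerSeq, dif_pos h, hfind, hk, Option.getD_some]

theorem eq_of_mem_answerSet_of_eq {x y : ℕ → Bool} (hx : x ∈ answerSet r) (hy : y ∈ answerSet r)
    {j k : ℕ} (hjk : j ≤ k) (h : x k = y k) : x j = y j := by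
  induction k, hjk using Nat.le_induction with
  | base => exact h
  | succ k _ ih =>
    refine ih ?_
    rcases hr : r k with _ | c
    · rw [← (hx k).1 hr, ← (hy k).1 hr, h]
    · rw [(hx k).2 c hr, (hy k).2 c hr]

theorem exists_answerSet_subset_pair (r : ℕ → Option Bool) :
    ∃ y z, answerSet r ⊆ {y, z} := by
  by_cases h : ∃ y ∈ answerSet r, ∃ z ∈ answerSet r, y ≠ z
  · obtain ⟨y, hy, z, hz, hne⟩ := h
    obtain ⟨i, hi⟩ := Function.ne_iff.1 hne
    refine ⟨y, z, fun x hx => ?_⟩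
    by_contra hcon
    simp only [Set.mem_insert_iff, Set.mem_singleton_iff, not_or] at hcon
    obtain ⟨j, hj⟩ := Function.ne_iff.1 hcon.1
    obtain ⟨l, hl⟩ := Function.ne_iff.1 hcon.2
    have h1 : y (i + j + l) ≠ z (i + j + l) :=
      fun h => hi (eq_of_mem_answerSet_of_eq hy hz (by omega) h)
    have h2 : x (i + j + l) ≠ y (i + j + l) :=
      fun h => hj (eq_of_mem_answerSet_of_eq hx hy (by omega) h)
    have h3 : x (i + j + l) ≠ z (i + j + l) :=
      fun h => hl (eq_of_mem_answerSet_of_eq hx hz (by omega) h)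
    revert h1 h2 h3
    cases x (i + j + l) <;> cases y (i + j + l) <;> cases z (i + j + l) <;> simp
  · push Not at h
    exact ⟨answerSeq r true, answerSeq r true, fun x hx =>
      Or.inl (h x hx _ (answerSeq_mem r true))⟩

theorem answerSet_mem_cardLeClass (r : ℕ → Option Bool) :
    answerSet r ∈ cardLeClass (ℕ → Bool) 2 := by
  obtain ⟨y, z, h⟩ := exists_answerSet_subset_pair r
  refine ⟨(Set.toFinite {y, z}).subset h, ⟨_, answerSeq_mem r true⟩, ?_⟩
  refine (Set.ncard_le_ncard h).trans ((Set.ncard_insert_le _ _).trans ?_)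
  simp

theorem answerSet_mem_cardEqClass {N : ℕ} (hr : ∀ k ≥ N, r k = none) :
    answerSet r ∈ cardEqClass (ℕ → Bool) 2 := by
  have h := answerSet_mem_cardLeClass r
  refine ⟨h.1, le_antisymm h.2.2 ?_⟩
  have hval : ∀ b, answerSeq r b N = b := fun b => by
    rw [answerSeq, dif_neg]
    rintro ⟨j, hj, hs⟩
    simp [hr j hj] at hs
  have hne : answerSeq r true ≠ answerSeq r false := fun he => by
    simpa [hval] using congrFun he N
  rw [← Set.ncard_pair hne]
  refine Set.ncard_le_ncard ?_ h.1
  rintro _ (rfl | rfl)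
  exacts [answerSeq_mem r _, answerSeq_mem r _]

theorem isClosed_answerStep (o : Option Bool) (k : ℕ) : IsClosed (answerStep o k) := by
  cases o with
  | none =>
    simpa [answerStep] using isClosed_eq (continuous_apply (k + 1)) (continuous_apply k)
  | some c => simpa [answerStep] using isClosed_eq (continuous_apply k) continuous_const

end AnswerSet

/-! ### Names of closed sets and of points -/

section Names

variable {γ : ℕ → ℕ → Bool}

theorem exists_ballCode_subset {X : Type*} [MetricSpace X] {α : ℕ → X} (hα : DenseRange α)
    {U : Set X} (hU : IsOpen U) {x : X} (hx : x ∈ U) :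
    ∃ c, x ∈ ballCode α c ∧ ballCode α c ⊆ U := by
  obtain ⟨ε, hε, hεU⟩ := Metric.isOpen_iff.1 hU x hx
  obtain ⟨b, hb⟩ := exists_nat_one_div_lt (half_pos hε)
  have hpos : (0 : ℝ) < 1 / ((b : ℝ) + 1) := by positivity
  obtain ⟨a, ha⟩ := hα.exists_dist_lt x hpos
  refine ⟨Nat.pair a (Nat.pair 1 b), ?_, ?_⟩
  · simpa [ballCode, ratCode] using ha
  · intro y hy
    refine hεU ?_
    simp only [ballCode, ratCode, Nat.unpair_pair, Metric.mem_ball, Nat.cast_one] at hy ⊢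
    have := dist_triangle_right y x (α a)
    linarith

theorem ballCode_zero {X : Type*} [MetricSpace X] (α : ℕ → X) : ballCode α 0 = ∅ := by
  simp [ballCode, ratCode]

open Classical in
/-- The entry with number `m` of a name of the intersection of the closed sets `C k`. -/
noncomputable def iInterName {X : Type*} [MetricSpace X] (α : ℕ → X) (C : ℕ → Set X) (m : ℕ) :
    ℕ :=
  if ballCode α m.unpair.2 ⊆ (C m.unpair.1)ᶜ then m.unpair.2 else 0

theorem psiMinus_iInterName {X : Type*} [MetricSpace X] {α : ℕ → X} (hα : DenseRange α)
    {C : ℕ → Set X} (hC : ∀ k, IsClosed (C k)) :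
    psiMinus α (iInterName α C) = {x | ∀ k, x ∈ C k} := by
  ext x
  constructor
  · intro hx k
    by_contra hxk
    obtain ⟨c, hxc, hc⟩ := exists_ballCode_subset hα (hC k).isOpen_compl hxk
    refine hx (Nat.pair k c) ?_
    simpa [iInterName, hc] using hxc
  · intro hx m hm
    unfold iInterName at hm
    split_ifs at hm with h
    · exact h hm (hx _)
    · simp [ballCode_zero] at hm

/-- The word formed by the first `k` entries of `x`. -/
def initialWord (x : ℕ → Bool) (k : ℕ) : List Bool := (List.range k).map x

@[simp] theorem length_initialWord (x : ℕ → Bool) (k : ℕ) : (initialWord x k).length = k := by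
  simp [initialWord]

theorem initialWord_succ (x : ℕ → Bool) (k : ℕ) :
    initialWord x (k + 1) = initialWord x k ++ [x k] := by
  simp [initialWord, List.range_succ]

theorem initialWord_eq_iff {x y : ℕ → Bool} {k : ℕ} :
    initialWord x k = initialWord y k ↔ ∀ i < k, x i = y i := by
  simp [initialWord]

theorem eventually_forall_lt_eq {E : Type*} [TopologicalSpace E] [DiscreteTopology E] (x : ℕ → E)
    (k : ℕ) : ∀ᶠ y in nhds x, ∀ i < k, y i = x i :=
  (Filter.eventually_all_finite (Set.finite_Iio k)).2 fun i _ =>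
    (continuous_apply i).continuousAt.eventually
      ((isOpen_discrete {x i}).mem_nhds rfl)

theorem eventually_initialWord_eq (x : ℕ → Bool) (k : ℕ) :
    ∀ᶠ y in nhds x, initialWord y k = initialWord x k :=
  (eventually_forall_lt_eq x k).mono fun _ hy => initialWord_eq_iff.2 hy

theorem isOpen_setOf_initialWord_mem (S : Set (List Bool)) (k : ℕ) :
    IsOpen {x | initialWord x k ∈ S} :=
  isOpen_iff_eventually.2 fun x hx =>
    (eventually_initialWord_eq x k).mono fun y hy => by
      rw [Set.mem_ofPred_eq, hy]; exact hx

theorem dist_lt_of_initialWord_eq {x y : ℕ → Bool} {j : ℕ}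
    (h : initialWord x (j + 1) = initialWord y (j + 1)) : dist x y < (2 : ℝ)⁻¹ ^ j := by
  have hmem : x ∈ PiNat.cylinder y (j + 1) :=
    PiNat.mem_cylinder_iff.2 (initialWord_eq_iff.1 h)
  have h1 : dist x y ≤ (1 / 2 : ℝ) ^ (j + 1) := by
    exact PiNat.mem_cylinder_iff_dist_le.1 hmem
  refine h1.trans_lt ?_
  rw [one_div]
  exact pow_lt_pow_right_of_lt_one₀ (by norm_num) (by norm_num) (Nat.lt_succ_self j)

open Classical in
/-- The number of an element of the dense sequence that starts with the word `w` of
length `k`. -/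
noncomputable def wordCode (γ : ℕ → ℕ → Bool) (k : ℕ) (w : List Bool) : ℕ :=
  if h : ∃ c, initialWord (γ c) k = w then h.choose else 0

theorem initialWord_wordCode (hγ : DenseRange γ) (x : ℕ → Bool) (k : ℕ) :
    initialWord (γ (wordCode γ k (initialWord x k))) k = initialWord x k := by
  have hex : ∃ c, initialWord (γ c) k = initialWord x k :=
    hγ.exists_mem_open (isOpen_setOf_initialWord_mem {initialWord x k} k) ⟨x, rfl⟩
  rw [wordCode, dif_pos hex]
  exact hex.choose_spec

end Names

/-! ### The tree of words approximating a closed set -/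

section Approximation

variable {γ : ℕ → ℕ → Bool} {n : ℕ} {p : Baire}

/-- The initial words of length `k` of points outside the first `s` balls listed by `p`. -/
def uncovered (γ : ℕ → ℕ → Bool) (p : Baire) (k s : ℕ) : Set (List Bool) :=
  (initialWord · k) '' {x | ∀ i < s, x ∉ ballCode γ (p i)}

/-- The first stage `s ≥ k` by which the balls listed by `p` leave at most `n + 1` words
uncovered at each length up to `k`. -/
noncomputable def stage (γ : ℕ → ℕ → Bool) (n : ℕ) (p : Baire) (k : ℕ) : ℕ :=
  sInf {s | k ≤ s ∧ ∀ j ≤ k, (uncovered γ p j s).ncard ≤ n + 1}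

/-- The `k`-th level of a narrow tree whose paths are the elements of `psiMinus γ p`. -/
noncomputable def approx (γ : ℕ → ℕ → Bool) (n : ℕ) (p : Baire) (k : ℕ) : Set (List Bool) :=
  uncovered γ p k (stage γ n p k)

theorem uncovered_anti (k : ℕ) {s t : ℕ} (h : s ≤ t) : uncovered γ p k t ⊆ uncovered γ p k s :=
  Set.image_mono fun _ hx i hi => hx i (hi.trans_le h)

theorem image_psiMinus_subset_uncovered (k s : ℕ) :
    (initialWord · k) '' psiMinus γ p ⊆ uncovered γ p k s :=
  Set.image_mono fun _ hx i _ => hx i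

theorem exists_uncovered_subset (γ : ℕ → ℕ → Bool) (p : Baire) (k : ℕ) :
    ∃ s, uncovered γ p k s ⊆ (initialWord · k) '' psiMinus γ p := by
  by_contra! hcon
  let S := (initialWord · k) '' psiMinus γ p
  let t : ℕ → Set (ℕ → Bool) := fun s =>
    (⋂ i < s, (ballCode γ (p i))ᶜ) ∩ {x | initialWord x k ∈ Sᶜ}
  have hclosed : ∀ s, IsClosed (t s) := fun s => by
    refine (isClosed_biInter fun i _ => Metric.isOpen_ball.isClosed_compl).inter ?_
    exact (isOpen_setOf_initialWord_mem S k).isClosed_compl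
  obtain ⟨x, hx⟩ := IsCompact.nonempty_iInter_of_sequence_nonempty_isCompact_isClosed t
    (fun s => Set.inter_subset_inter_left _
      (Set.biInter_subset_biInter_left fun i (hi : i < s) => hi.trans (Nat.lt_succ_self s)))
    (fun s => by
      obtain ⟨_, ⟨x, hx, rfl⟩, hxS⟩ := Set.not_subset.1 (hcon s)
      exact ⟨x, by simpa using hx, hxS⟩)
    (hclosed 0).isCompact hclosed
  rw [Set.mem_iInter] at hx
  refine (hx 0).2 ⟨x, fun i => ?_, rfl⟩
  have := (hx (i + 1)).1
  simp only [Set.mem_iInter] at this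
  exact this i (Nat.lt_succ_self i)

theorem stage_spec (hp : psiMinus γ p ∈ cardLeClass (ℕ → Bool) (n + 1)) (k : ℕ) :
    k ≤ stage γ n p k ∧ ∀ j ≤ k, (uncovered γ p j (stage γ n p k)).ncard ≤ n + 1 := by
  choose s hs using exists_uncovered_subset γ p
  refine Nat.sInf_mem (s := {s | k ≤ s ∧ ∀ j ≤ k, (uncovered γ p j s).ncard ≤ n + 1})
    ⟨k + ∑ j ∈ Finset.range (k + 1), s j, by simp, fun j hj => ?_⟩
  have hle : s j ≤ k + ∑ j ∈ Finset.range (k + 1), s j :=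
    (Finset.single_le_sum (f := s) (fun _ _ => Nat.zero_le _)
      (Finset.mem_range.2 (Nat.lt_succ_of_le hj))).trans (Nat.le_add_left _ _)
  calc (uncovered γ p j _).ncard ≤ ((initialWord · j) '' psiMinus γ p).ncard :=
        Set.ncard_le_ncard ((uncovered_anti j hle).trans (hs j)) (hp.1.image _)
    _ ≤ (psiMinus γ p).ncard := Set.ncard_image_le hp.1
    _ ≤ n + 1 := hp.2.2

theorem stage_le_stage_succ (hp : psiMinus γ p ∈ cardLeClass (ℕ → Bool) (n + 1)) (k : ℕ) :
    stage γ n p k ≤ stage γ n p (k + 1) :=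
  have h := stage_spec hp (k + 1)
  Nat.sInf_le ⟨by omega, fun j hj => h.2 j (by omega)⟩

theorem isNarrowTree_approx (hp : psiMinus γ p ∈ cardLeClass (ℕ → Bool) (n + 1)) :
    IsNarrowTree n (approx γ n p) where
  length_eq k := by rintro _ ⟨x, -, rfl⟩; simp
  parent_mem k w b := by
    rintro ⟨x, hx, h⟩
    simp only [initialWord_succ] at h
    obtain ⟨rfl, -⟩ := List.append_inj' h rfl
    exact uncovered_anti k (stage_le_stage_succ hp k) ⟨x, hx, rfl⟩
  nonempty k := (hp.2.1.image _).mono (image_psiMinus_subset_uncovered k _)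
  ncard_le k := (stage_spec hp k).2 k le_rfl

theorem mem_psiMinus_of_initialWord_mem (hp : psiMinus γ p ∈ cardLeClass (ℕ → Bool) (n + 1))
    {x : ℕ → Bool} (hx : ∀ k, initialWord x k ∈ approx γ n p k) : x ∈ psiMinus γ p := by
  intro i hi
  obtain ⟨ε, hε, hball⟩ := Metric.isOpen_iff.1 Metric.isOpen_ball x hi
  obtain ⟨m, hm⟩ := exists_pow_lt_of_lt_one hε (show (2 : ℝ)⁻¹ < 1 by norm_num)
  obtain ⟨y, hy, hyx⟩ := hx (i + m + 1)
  refine hy i (by have := (stage_spec hp (i + m + 1)).1; omega) (hball ?_)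
  refine (dist_lt_of_initialWord_eq (initialWord_eq_iff.2 fun j hj => ?_)).trans hm
  exact initialWord_eq_iff.1 hyx j (by omega)

theorem exists_release_eq_none (hp : psiMinus γ p ∈ cardEqClass (ℕ → Bool) (n + 1)) :
    ∃ N, ∀ i, ∀ k ≥ N, release n (approx γ n p) i k = none := by
  obtain ⟨hfin, hcard⟩ := hp
  have hle : psiMinus γ p ∈ cardLeClass (ℕ → Bool) (n + 1) :=
    ⟨hfin, Set.nonempty_of_ncard_ne_zero (by omega), hcard.le⟩
  have hinj : ∀ᶠ k in Filter.atTop, Set.InjOn (initialWord · k) (psiMinus γ p) := by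
    refine (Filter.eventually_all_finite hfin).2 fun x _ => ?_
    suffices h : ∀ y ∈ psiMinus γ p, ∀ᶠ k in Filter.atTop,
        initialWord x k = initialWord y k → x = y from
      ((Filter.eventually_all_finite hfin).2 h).mono fun k hk y hy => hk y hy
    intro y _
    by_cases hxy : x = y
    · simp [hxy]
    · obtain ⟨i, hi⟩ := Function.ne_iff.1 hxy
      filter_upwards [Filter.eventually_gt_atTop i] with k hk h
      exact absurd (initialWord_eq_iff.1 h i hk) hi
  obtain ⟨N, hN⟩ := Filter.eventually_atTop.1 hinj
  have heq : ∀ k ≥ N, (initialWord · k) '' psiMinus γ p = approx γ n p k := fun k hk =>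
    Set.eq_of_subset_of_ncard_le (image_psiMinus_subset_uncovered k _)
      (by rw [(hN k hk).ncard_image, hcard]
          exact (isNarrowTree_approx hle).ncard_le k)
      ((isNarrowTree_approx hle).finite k)
  refine ⟨N, fun i k hk => if_neg ?_⟩
  rintro ⟨w, ⟨hw, hw'⟩, -⟩
  refine hw' fun b => ?_
  obtain ⟨v, hv, hp⟩ := hw b
  rw [← heq k hk] at hv
  obtain ⟨x, hx, rfl⟩ := hv
  refine ⟨initialWord x (k + 1), image_psiMinus_subset_uncovered _ _ ⟨x, hx, rfl⟩, ?_⟩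
  rw [initialWord_succ]
  exact hp.trans (List.prefix_append _ _)

/-! ### Continuity of the construction -/

theorem index_zero (n : ℕ) (T : ℕ → Set (List Bool)) : index n T 0 = fun _ => 0 := rfl

theorem index_succ (n : ℕ) (T : ℕ → Set (List Bool)) (k : ℕ) :
    index n T (k + 1) = extendIndex n (branching (T k) ∩ branching (T (k + 1)))
      (branching (T (k + 1))) (index n T k) := rfl

theorem release_congr {T T' : ℕ → Set (List Bool)} {i k : ℕ} (h : index n T k = index n T' k)
    (hk : T k = T' k) (hk_succ : T (k + 1) = T' (k + 1)) : release n T i k = release n T' i k := by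
  unfold release
  rw [h, hk, hk_succ]

theorem direction_congr {T T' : ℕ → Set (List Bool)} {x x' : ℕ → ℕ → Bool} {k : ℕ}
    {w : List Bool} (hT : T (k + 1) = T' (k + 1))
    (hi : index n T (k + 1) w = index n T' (k + 1) w)
    (hx : x (index n T' (k + 1) w) (k + 1) = x' (index n T' (k + 1) w) (k + 1)) :
    direction n T x k w = direction n T' x' k w := by
  unfold direction
  rw [hT, hi, hx]

theorem eventually_approx_eq (hp : psiMinus γ p ∈ cardLeClass (ℕ → Bool) (n + 1)) (k : ℕ) :
    ∀ᶠ q in nhds p, approx γ n q k = approx γ n p k := by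
  filter_upwards [eventually_forall_lt_eq p (stage γ n p k)] with q hq
  have hunc : ∀ s ≤ stage γ n p k, ∀ j, uncovered γ q j s = uncovered γ p j s := by
    intro s hs j
    refine congrArg _ (Set.ext fun x => forall₂_congr fun i hi => ?_)
    rw [hq i (by omega)]
  have hspec := stage_spec hp k
  have hmem : stage γ n p k ∈ {s | k ≤ s ∧ ∀ j ≤ k, (uncovered γ q j s).ncard ≤ n + 1} :=
    ⟨hspec.1, fun j hj => by rw [hunc _ le_rfl]; exact hspec.2 j hj⟩
  have hle : stage γ n q k ≤ stage γ n p k := Nat.sInf_le hmem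
  have hqmem := Nat.sInf_mem ⟨_, hmem⟩
  have hge : stage γ n p k ≤ stage γ n q k :=
    Nat.sInf_le ⟨hqmem.1, fun j hj => by rw [← hunc _ hle]; exact hqmem.2 j hj⟩
  rw [approx, le_antisymm hle hge, hunc _ le_rfl, approx]

theorem eventually_index_eq (hp : psiMinus γ p ∈ cardLeClass (ℕ → Bool) (n + 1)) (k : ℕ) :
    ∀ᶠ q in nhds p, index n (approx γ n q) k = index n (approx γ n p) k := by
  induction k with
  | zero => simp only [index_zero, Filter.eventually_true]
  | succ k ih =>
    filter_upwards [ih, eventually_approx_eq hp k, eventually_approx_eq hp (k + 1)]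
      with q h1 h2 h3
    rw [index_succ, index_succ, h1, h2, h3]

theorem eventually_release_eq (hp : psiMinus γ p ∈ cardLeClass (ℕ → Bool) (n + 1)) (i k : ℕ) :
    ∀ᶠ q in nhds p, release n (approx γ n q) i k = release n (approx γ n p) i k := by
  filter_upwards [eventually_index_eq hp k, eventually_approx_eq hp k,
    eventually_approx_eq hp (k + 1)] with q h1 h2 h3
  exact release_congr h1 h2 h3

/-! ### The reduction -/

/-- A name of the `n`-tuple of sets of answers to the questions posed for `p`. -/
noncomputable def questionName (γ : ℕ → ℕ → Bool) (n : ℕ) (p : Baire) : Baire := fun m =>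
  iInterName γ (fun k => answerStep (release n (approx γ n p) (m % n) k) k) (m / n)

theorem projB_questionName (i : Fin n) :
    projB n i (questionName γ n p) =
      iInterName γ fun k => answerStep (release n (approx γ n p) i k) k := by
  ext k
  have hn : 0 < n := i.pos
  simp only [projB, questionName]
  rw [Nat.add_comm, Nat.add_mul_mod_self_right, Nat.mod_eq_of_lt i.2,
    Nat.add_mul_div_right _ _ hn, Nat.div_eq_of_lt i.2, zero_add]

theorem continuousOn_questionName :
    ContinuousOn (questionName γ n) {p | psiMinus γ p ∈ cardLeClass (ℕ → Bool) (n + 1)} := by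
  refine continuousOn_pi.2 fun m p hp => ContinuousAt.continuousWithinAt ?_
  refine (continuousAt_const (y := questionName γ n p m)).congr ?_
  filter_upwards [eventually_release_eq hp (m % n) (m / n).unpair.1] with q hq
  rw [questionName, questionName, iInterName, iInterName, hq]

/-- The answers encoded by a name `q` of an `n`-tuple of points. -/
def answers (γ : ℕ → ℕ → Bool) (n : ℕ) (q : Baire) (i k : ℕ) : Bool := γ (q (k * n + i)) k

/-- The even-indexed part of a sequence, which is the first component of a pair. -/
def fstB (r : Baire) : Baire := fun k => r (2 * k)

/-- The odd-indexed part of a sequence, which is the second component of a pair. -/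
def sndB (r : Baire) : Baire := fun k => r (2 * k + 1)

@[simp] theorem fstB_pairB (p q : Baire) : fstB (pairB p q) = p := by
  ext k
  simp [fstB, pairB]

@[simp] theorem sndB_pairB (p q : Baire) : sndB (pairB p q) = q := by
  ext k
  simp only [sndB, pairB]
  rw [if_neg (by omega)]
  congr 1
  omega

/-- The name of the point found by following the answers. -/
noncomputable def solutionName (γ : ℕ → ℕ → Bool) (n : ℕ) (r : Baire) : Baire := fun j =>
  wordCode γ (j + 1) (descend n (approx γ n (fstB r)) (answers γ n (sndB r)) (j + 1))

theorem eventually_descend_eq {r : Baire}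
    (hr : psiMinus γ (fstB r) ∈ cardLeClass (ℕ → Bool) (n + 1)) (k : ℕ) :
    ∀ᶠ s in nhds r, descend n (approx γ n (fstB s)) (answers γ n (sndB s)) k =
      descend n (approx γ n (fstB r)) (answers γ n (sndB r)) k := by
  induction k with
  | zero => exact Filter.Eventually.of_forall fun _ => rfl
  | succ k ih =>
    have hcont : Filter.Tendsto fstB (nhds r) (nhds (fstB r)) :=
      (continuous_pi fun k => continuous_apply (2 * k)).continuousAt
    set w := descend n (approx γ n (fstB r)) (answers γ n (sndB r)) k
    filter_upwards [ih, hcont.eventually (eventually_approx_eq hr (k + 1)),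
      hcont.eventually (eventually_index_eq hr (k + 1)),
      eventually_forall_lt_eq r
        (2 * ((k + 1) * n + index n (approx γ n (fstB r)) (k + 1) w) + 2)] with s h1 h2 h3 h4
    have h5 : answers γ n (sndB s) (index n (approx γ n (fstB r)) (k + 1) w) (k + 1) =
        answers γ n (sndB r) (index n (approx γ n (fstB r)) (k + 1) w) (k + 1) := by
      simp only [answers, sndB]
      rw [h4 _ (by omega)]
    change descend n _ _ k ++ [direction n _ _ k (descend n _ _ k)] = w ++ [direction n _ _ k w]
    rw [h1, direction_congr h2 (by rw [h3]) h5]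

theorem continuousOn_solutionName : ContinuousOn (solutionName γ n)
    {r | psiMinus γ (fstB r) ∈ cardLeClass (ℕ → Bool) (n + 1)} := by
  refine continuousOn_pi.2 fun j r hr => ContinuousAt.continuousWithinAt ?_
  refine (continuousAt_const (y := solutionName γ n r j)).congr ?_
  filter_upwards [eventually_descend_eq hr (j + 1)] with s hs
  simp only [solutionName, hs]

theorem answers_eq {q : Baire} {y : Fin n → ℕ → Bool} (hq : (piRep n (pointRep γ)).R q y)
    (i : Fin n) : answers γ n q i = y i := by
  ext k
  have h : dist (y i) (γ (q (k * n + i))) < (1 / 2 : ℝ) ^ k := by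
    rw [one_div]
    exact hq i k
  exact (PiNat.apply_eq_of_dist_lt h le_rfl).symm

theorem solutionName_spec (hγ : DenseRange γ) {q : Baire}
    (hp : psiMinus γ p ∈ cardLeClass (ℕ → Bool) (n + 1))
    (hq : ∀ i < n, answers γ n q i ∈ answerSet (release n (approx γ n p) i)) :
    ∃ z ∈ psiMinus γ p, (pointRep γ).R (solutionName γ n (pairB p q)) z := by
  set T := approx γ n p
  set x := answers γ n q
  let z : ℕ → Bool := fun k => direction n T x k (descend n T x k)
  have hz : ∀ k, descend n T x k = initialWord z k := by
    intro k
    induction k with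
    | zero => rfl
    | succ k ih => rw [initialWord_succ, ← ih]; rfl
  refine ⟨z, mem_psiMinus_of_initialWord_mem hp fun k => ?_, fun j => ?_⟩
  · rw [← hz]
    exact ((isNarrowTree_approx hp).descend_mem hq k).1
  · refine dist_lt_of_initialWord_eq ?_
    simp only [solutionName, fstB_pairB, sndB_pairB]
    rw [show descend n (approx γ n p) (answers γ n q) (j + 1) = initialWord z (j + 1) from hz _,
      initialWord_wordCode hγ]

theorem wRed_choiceFn (hγ : DenseRange γ) {𝔄 𝔅 : Set (Set (ℕ → Bool))}
    (h𝔄 : 𝔄 ⊆ cardLeClass (ℕ → Bool) (n + 1))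
    (h𝔅 : ∀ p, psiMinus γ p ∈ 𝔄 → ∀ i, answerSet (release n (approx γ n p) i) ∈ 𝔅) :
    WRed (closedRep γ) (pointRep γ) (piRep n (closedRep γ)) (piRep n (pointRep γ))
      (choiceFn 𝔄) (piFn n (choiceFn 𝔅)) := by
  refine ⟨questionName γ n, solutionName γ n, _, _, continuousOn_questionName,
    continuousOn_solutionName, ?_⟩
  rintro G hG p _ rfl ⟨_, hA, -⟩
  have hp := h𝔄 hA
  refine ⟨hp, by simpa using hp, ?_⟩
  obtain ⟨y, hy, hqy⟩ := hG (questionName γ n p)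
    (fun i => answerSet (release n (approx γ n p) i))
    (fun i => by
      rw [projB_questionName]
      exact (psiMinus_iInterName hγ fun k => isClosed_answerStep _ k).symm)
    ⟨fun i => answerSeq (release n (approx γ n p) i) true,
      fun i => ⟨h𝔅 p hA i, answerSeq_mem _ _⟩⟩
  obtain ⟨z, hz, hzR⟩ := solutionName_spec hγ hp (q := G (questionName γ n p)) fun i hi => by
    have := answers_eq hqy ⟨i, hi⟩
    rw [show answers γ n (G (questionName γ n p)) i = y ⟨i, hi⟩ from this]
    exact (hy ⟨i, hi⟩).2
  exact ⟨z, ⟨hA, hz⟩, hzR⟩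

end Approximation

/-- For every n ≥ 1, C_{{0,1}^ℕ,#=n+1} ≤_W (C_{{0,1}^ℕ,#=2})^n and
C_{{0,1}^ℕ,#≤n+1} ≤_W (C_{{0,1}^ℕ,#≤2})^n. -/
theorem stmt9 (n : ℕ) (hn : 1 ≤ n) (γ : ℕ → (ℕ → Bool)) (hγ : DenseRange γ) :
    WRed (closedRep γ) (pointRep γ) (piRep n (closedRep γ)) (piRep n (pointRep γ))
        (choiceFn (cardEqClass (ℕ → Bool) (n + 1)))
        (piFn n (choiceFn (cardEqClass (ℕ → Bool) 2)))
    ∧ WRed (closedRep γ) (pointRep γ) (piRep n (closedRep γ)) (piRep n (pointRep γ))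
        (choiceFn (cardLeClass (ℕ → Bool) (n + 1)))
        (piFn n (choiceFn (cardLeClass (ℕ → Bool) 2))) := by
  refine ⟨wRed_choiceFn hγ ?_ fun p hp i => ?_,
    wRed_choiceFn hγ subset_rfl fun p _ i => answerSet_mem_cardLeClass _⟩
  · rintro A ⟨hfin, hcard⟩
    exact ⟨hfin, Set.nonempty_of_ncard_ne_zero (by omega), hcard.le⟩
  · obtain ⟨N, hN⟩ := exists_release_eq_none hp
    exact answerSet_mem_cardEqClass (hN i)
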